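/- Let V₁, V₂, V₃ be finite-dimensional vector spaces and R : V₁ ⇢ V₂, R' : V₂ ⇢ V₃ linear relations. Let R' ⋄ R = (R' × R) ∩ (V₃ × Δ(V₂) × V₁) where Δ(V₂) is the diagonal. Then dim(R' ⋄ R) = dim R' + dim R − dim V₂ + dim(ker(ann♮(R')) ∩ ker(ann♮(R)ᵀ)), and dim(R' ∘ R) = dim(R' ⋄ R) − dim(ker(R') ∩ ker(Rᵀ)). -/

import Mathlib

open Module

variable {K : Type*} [Field K]

/-- Composition of linear relations: a relation `V₁ ⇢ V₂` is a subspace of `V₂ × V₁`. -/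
def LinRel.comp {V₁ V₂ V₃ : Type*}
    [AddCommGroup V₁] [Module K V₁] [AddCommGroup V₂] [Module K V₂]
    [AddCommGroup V₃] [Module K V₃]
    (R' : Submodule K (V₃ × V₂)) (R : Submodule K (V₂ × V₁)) :
    Submodule K (V₃ × V₁) where
  carrier := {p | ∃ b, (p.1, b) ∈ R' ∧ (b, p.2) ∈ R}
  add_mem' := by
    rintro x y ⟨b, hb', hb⟩ ⟨c, hc', hc⟩
    exact ⟨b + c, R'.add_mem hb' hc', R.add_mem hb hc⟩
  zero_mem' := ⟨0, R'.zero_mem, R.zero_mem⟩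
  smul_mem' := by
    rintro a x ⟨b, hb', hb⟩
    exact ⟨a • b, R'.smul_mem a hb', R.smul_mem a hb⟩

/-- `ann♮(R) : V₁* ⇢ V₂*`. -/
def LinRel.ann {V₁ V₂ : Type*}
    [AddCommGroup V₁] [Module K V₁] [AddCommGroup V₂] [Module K V₂]
    (R : Submodule K (V₂ × V₁)) :
    Submodule K (Module.Dual K V₂ × Module.Dual K V₁) where
  carrier := {μ | ∀ v ∈ R, μ.2 v.2 = μ.1 v.1}
  add_mem' := by
    intro x y hx hy v hv
    have h1 := hx v hv
    have h2 := hy v hv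
    simp only [Prod.fst_add, Prod.snd_add, LinearMap.add_apply]
    rw [h1, h2]
  zero_mem' := by intro v hv; simp
  smul_mem' := by
    intro a x hx v hv
    have h1 := hx v hv
    simp only [Prod.smul_fst, Prod.smul_snd, LinearMap.smul_apply]
    rw [h1]

/-- The kernel of a relation `R : V₁ ⇢ V₂`, namely `{v₁ | (0, v₁) ∈ R}`. -/
def LinRel.ker {V₁ V₂ : Type*}
    [AddCommGroup V₁] [Module K V₁] [AddCommGroup V₂] [Module K V₂]
    (R : Submodule K (V₂ × V₁)) : Submodule K V₁ :=
  R.comap (LinearMap.inr K V₂ V₁)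

/-- The transpose relation `Rᵀ : V₂ ⇢ V₁` of `R : V₁ ⇢ V₂`. -/
def LinRel.transpose {V₁ V₂ : Type*}
    [AddCommGroup V₁] [Module K V₁] [AddCommGroup V₂] [Module K V₂]
    (R : Submodule K (V₂ × V₁)) : Submodule K (V₁ × V₂) :=
  R.comap (LinearEquiv.prodComm K V₁ V₂).toLinearMap

/-- `R' ⋄ R = (R' × R) ∩ (V₃ × Δ(V₂) × V₁)`. -/
def LinRel.diamond {V₁ V₂ V₃ : Type*}
    [AddCommGroup V₁] [Module K V₁] [AddCommGroup V₂] [Module K V₂]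
    [AddCommGroup V₃] [Module K V₃]
    (R' : Submodule K (V₃ × V₂)) (R : Submodule K (V₂ × V₁)) :
    Submodule K ((V₃ × V₂) × (V₂ × V₁)) :=
  (R'.prod R) ⊓ LinearMap.ker
    ((LinearMap.snd K V₃ V₂ ∘ₗ LinearMap.fst K (V₃ × V₂) (V₂ × V₁)) -
     (LinearMap.fst K V₂ V₁ ∘ₗ LinearMap.snd K (V₃ × V₂) (V₂ × V₁)))

theorem LinRel.rank_nullity_aux {V W : Type*}
    [AddCommGroup V] [Module K V] [FiniteDimensional K V]
    [AddCommGroup W] [Module K W] (P : Submodule K V) (f : V →ₗ[K] W) :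
    finrank K ↥(P.map f) + finrank K ↥(P ⊓ LinearMap.ker f) = finrank K ↥P := by
  have h := LinearMap.finrank_range_add_finrank_ker (f.domRestrict P)
  rw [LinearMap.range_domRestrict, LinearMap.ker_domRestrict] at h
  rw [← h, ← Submodule.map_comap_subtype, Submodule.finrank_map_subtype_eq]

/-- Dimension formulas for the composition of linear relations:
`dim(R' ⋄ R) = dim R' + dim R − dim V₂ + dim(ker(ann♮ R') ∩ ker((ann♮ R)ᵀ))` and
`dim(R' ∘ R) = dim(R' ⋄ R) − dim(ker R' ∩ ker Rᵀ)`, stated additively. -/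
theorem dim_diamond_and_comp {V₁ V₂ V₃ : Type*}
    [AddCommGroup V₁] [Module K V₁] [FiniteDimensional K V₁]
    [AddCommGroup V₂] [Module K V₂] [FiniteDimensional K V₂]
    [AddCommGroup V₃] [Module K V₃] [FiniteDimensional K V₃]
    (R : Submodule K (V₂ × V₁)) (R' : Submodule K (V₃ × V₂)) :
    finrank K ↥(LinRel.diamond R' R) + finrank K V₂ =
      finrank K ↥R' + finrank K ↥R +
        finrank K ↥(LinRel.ker (LinRel.ann R') ⊓
          LinRel.ker (LinRel.transpose (LinRel.ann R))) ∧
    finrank K ↥(LinRel.comp R' R) +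
        finrank K ↥(LinRel.ker R' ⊓ LinRel.ker (LinRel.transpose R)) =
      finrank K ↥(LinRel.diamond R' R) := by
  constructor
  · set f := ((LinearMap.snd K V₃ V₂ ∘ₗ LinearMap.fst K (V₃ × V₂) (V₂ × V₁)) -
     (LinearMap.fst K V₂ V₁ ∘ₗ LinearMap.snd K (V₃ × V₂) (V₂ × V₁))) with hf
    have h1 := LinRel.rank_nullity_aux (R'.prod R) f
    have h2 : finrank K ↥(R'.prod R) = finrank K ↥R' + finrank K ↥R := by
      let e : ↥(R'.prod R) ≃ₗ[K] ↥R' × ↥R :=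
        { toFun := fun p => (⟨p.1.1, p.2.1⟩, ⟨p.1.2, p.2.2⟩)
          map_add' := fun _ _ => rfl
          map_smul' := fun _ _ => rfl
          invFun := fun q => ⟨(q.1.1, q.2.1), ⟨q.1.2, q.2.2⟩⟩
          left_inv := fun _ => rfl
          right_inv := fun _ => rfl }
      rw [e.finrank_eq, finrank_prod]
    have h3 : LinRel.ker (LinRel.ann R') ⊓ LinRel.ker (LinRel.transpose (LinRel.ann R))
        = ((R'.prod R).map f).dualAnnihilator := by
      ext μ
      rw [Submodule.mem_dualAnnihilator]
      constructor
      · rintro ⟨ha, hb⟩ _ ⟨⟨x, y⟩, ⟨hx, hy⟩, rfl⟩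
        have e1 : μ x.2 = 0 := ha x hx
        have e2 : 0 = μ y.1 := hb y hy
        simp [hf, e1, ← e2]
      · intro h
        refine ⟨fun x hx => ?_, fun y hy => ?_⟩
        · have := h _ ⟨(x, 0), ⟨hx, R.zero_mem⟩, rfl⟩
          simpa [hf] using this
        · have := h _ ⟨(0, y), ⟨R'.zero_mem, hy⟩, rfl⟩
          have e : μ y.1 = 0 := by simpa [hf] using this
          exact e.symm
    have h4 := Subspace.finrank_add_finrank_dualAnnihilator_eq ((R'.prod R).map f)
    have h5 : LinRel.diamond R' R = R'.prod R ⊓ LinearMap.ker f := rfl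
    rw [h3, h5]
    omega
  · let g : (V₃ × V₂) × (V₂ × V₁) →ₗ[K] V₃ × V₁ :=
      (LinearMap.fst K V₃ V₂).prodMap (LinearMap.snd K V₂ V₁)
    have h1 := LinRel.rank_nullity_aux (LinRel.diamond R' R) g
    have h2 : (LinRel.diamond R' R).map g = LinRel.comp R' R := by
      ext ⟨c, a⟩
      constructor
      · rintro ⟨⟨⟨x, y⟩, ⟨z, w⟩⟩, ⟨⟨hx, hy⟩, hk⟩, he⟩
        have e : y = z := by simpa [sub_eq_zero] using hk
        subst e
        obtain ⟨rfl, rfl⟩ : x = c ∧ w = a := by simpa [g] using he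
        exact ⟨y, hx, hy⟩
      · rintro ⟨b, hb, hb'⟩
        exact ⟨((c, b), (b, a)), ⟨⟨hb, hb'⟩, by simp⟩, rfl⟩
    let j : V₂ →ₗ[K] (V₃ × V₂) × (V₂ × V₁) :=
      (LinearMap.inr K V₃ V₂).prod (LinearMap.inl K V₂ V₁)
    have hj : Function.Injective j := by
      intro x y h
      exact congrArg (fun p => p.1.2) h
    have h3 : (LinRel.ker R' ⊓ LinRel.ker (LinRel.transpose R)).map j =
        LinRel.diamond R' R ⊓ LinearMap.ker g := by
      ext ⟨⟨x, y⟩, ⟨z, w⟩⟩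
      constructor
      · rintro ⟨b, ⟨hb, hb'⟩, he⟩
        rw [← he]
        exact ⟨⟨⟨hb, hb'⟩, by simp [j]⟩, by simp [g, j]⟩
      · rintro ⟨⟨⟨hx, hy⟩, hk⟩, he⟩
        have e : y = z := by simpa [sub_eq_zero] using hk
        subst e
        obtain ⟨rfl, rfl⟩ : x = 0 ∧ w = 0 := by simpa [g] using he
        exact ⟨y, ⟨hx, hy⟩, rfl⟩
    rw [← h2, ← h1, ← h3, (Submodule.equivMapOfInjective j hj _).finrank_eq]
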